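/- (Non-Abelian Julia–Zee theorem.) Let U : [0,∞) → [0,∞) be continuously differentiable with U(s) = 0 exactly for s = θ², where θ² ≥ 0, and set V(Φ) = U(|Φ|²). Let (Φ, A₁, A₂, A₀), all smooth maps ℝ² → ℝ³, be a static finite-energy solution of the SU(2) Yang–Mills–Higgs equations D^μF_{μ i} + Φ × D_iΦ = 0, D^μD_μΦ + δV/δΦ = 0, and the Gauss-law constraint D^μF_{μ 0} + Φ × D₀Φ = 0, with finite total energy ∫_{ℝ²} [ ¼ F_{i j}·F_{i j} + ½ F_{0 i}·F_{0 i} + ½ D_iΦ·D_iΦ + ½ D₀Φ·D₀Φ + V(Φ) ] dx < ∞. Then either A₀ ≡ 0 on ℝ², or else the solution is trivial: |Φ| ≡ θ, F_{i j} ≡ 0, F_{0 i} ≡ 0, D₀Φ ≡ 0, D_iΦ ≡ 0, and E(A₀) = 0. -/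

import Mathlib

/-!
The non-Abelian Julia–Zee theorem (Theorem 3.1 of Spruck–Yang): a static
finite-energy solution of the SU(2) Yang–Mills–Higgs equations on ℝ² either
has A₀ ≡ 0, or is trivial: |Φ| ≡ θ, F_{ij} ≡ 0, F_{i0} ≡ 0, D₀Φ ≡ 0, D_iΦ ≡ 0
and E(A₀) = 0.
-/

open MeasureTheory

noncomputable section

/-- The plane ℝ². -/
abbrev Plane : Type := EuclideanSpace ℝ (Fin 2)

/-- Euclidean ℝ³. -/
abbrev V3 : Type := EuclideanSpace ℝ (Fin 3)

/-- The vector cross product on ℝ³. -/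
def cross (a b : V3) : V3 :=
  (WithLp.equiv 2 (Fin 3 → ℝ)).symm
    ![a 1 * b 2 - a 2 * b 1, a 2 * b 0 - a 0 * b 2, a 0 * b 1 - a 1 * b 0]

/-- Partial derivative of an ℝ³-valued field in the `i`-th coordinate direction. -/
def pd (i : Fin 2) (f : Plane → V3) (x : Plane) : V3 :=
  fderiv ℝ f x (EuclideanSpace.single i 1)

/-- The spatial Yang–Mills curvature F_{ij} = ∂ᵢA_j − ∂_jAᵢ + Aᵢ × A_j. -/
def curv (A : Fin 2 → Plane → V3) (i j : Fin 2) (x : Plane) : V3 :=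
  pd i (A j) x - pd j (A i) x + cross (A i x) (A j x)

/-- The static electric field strength F_{i0} = ∂ᵢA₀ + Aᵢ × A₀. -/
def Fel (A : Fin 2 → Plane → V3) (A₀ : Plane → V3) (i : Fin 2) (x : Plane) : V3 :=
  pd i A₀ x + cross (A i x) (A₀ x)

/-- The spatial gauge-covariant derivative D_iΦ = ∂ᵢΦ + Aᵢ × Φ of the adjoint
Higgs field. -/
def covD (A : Fin 2 → Plane → V3) (Φ : Plane → V3) (i : Fin 2) (x : Plane) : V3 :=
  pd i Φ x + cross (A i x) (Φ x)

/-- Partial derivative of a real-valued function in the `i`-th coordinate direction. -/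
def spd (i : Fin 2) (f : Plane → ℝ) (x : Plane) : ℝ :=
  fderiv ℝ f x (EuclideanSpace.single i 1)

@[simp] lemma cross_apply_zero (a b : V3) : cross a b 0 = a 1 * b 2 - a 2 * b 1 := rfl

@[simp] lemma cross_apply_one (a b : V3) : cross a b 1 = a 2 * b 0 - a 0 * b 2 := rfl

@[simp] lemma cross_apply_two (a b : V3) : cross a b 2 = a 0 * b 1 - a 1 * b 0 := rfl

lemma inner_eq_sum_three (a b : V3) : inner ℝ a b = a 0 * b 0 + a 1 * b 1 + a 2 * b 2 := by
  simp [PiLp.inner_apply, Fin.sum_univ_three, mul_comm]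

lemma norm_sq_cross (a b : V3) :
    ‖cross a b‖ ^ 2 = ‖a‖ ^ 2 * ‖b‖ ^ 2 - inner ℝ a b ^ 2 := by
  simp only [← real_inner_self_eq_norm_sq, inner_eq_sum_three, cross_apply_zero, cross_apply_one,
    cross_apply_two]
  ring

lemma inner_cross_left_add (a u v : V3) :
    inner ℝ (cross a u) v + inner ℝ u (cross a v) = 0 := by
  simp only [inner_eq_sum_three, cross_apply_zero, cross_apply_one, cross_apply_two]
  ring

lemma inner_cross_eq (a b c : V3) : inner ℝ a (cross b c) = inner ℝ (cross a b) c := by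
  simp only [inner_eq_sum_three, cross_apply_zero, cross_apply_one, cross_apply_two]
  ring

lemma cross_jacobi (a b c : V3) :
    cross (cross a b) c = cross a (cross b c) - cross b (cross a c) := by
  ext k
  fin_cases k <;> simp <;> ring

lemma cross_neg_right (a b : V3) : cross a (-b) = -cross a b := by
  ext k
  fin_cases k <;> simp <;> ring

lemma cross_neg_left (a b : V3) : cross (-a) b = -cross a b := by
  ext k
  fin_cases k <;> simp <;> ring

lemma cross_add_left (a b c : V3) : cross (a + b) c = cross a c + cross b c := by
  ext k
  fin_cases k <;> simp <;> ring

lemma cross_swap (a b : V3) : cross a b = -cross b a := by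
  ext k
  fin_cases k <;> simp <;> ring

lemma cross_add_right (a b c : V3) : cross a (b + c) = cross a b + cross a c := by
  ext k
  fin_cases k <;> simp <;> ring

lemma cross_zero_right (a : V3) : cross a 0 = 0 := by
  ext k
  fin_cases k <;> simp

lemma eq_zero_of_inner_of_cross {a b : V3} (ha : a ≠ 0) (h : inner ℝ a b = 0)
    (h' : cross a b = 0) : b = 0 := by
  have := norm_sq_cross a b
  rw [h, h'] at this
  have ha' : ‖a‖ ^ 2 ≠ 0 := by simpa using ha
  simpa [ha'] using this

lemma pd_apply {f : Plane → V3} (hf : Differentiable ℝ f) (i : Fin 2) (x : Plane) (k : Fin 3) :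
    pd i f x k = spd i (fun y => f y k) x := by
  unfold pd spd
  have h := ((EuclideanSpace.proj k : V3 →L[ℝ] ℝ).hasFDerivAt (x := f x)).comp x
    (hf x).hasFDerivAt
  have h2 : HasFDerivAt (fun y => f y k) ((EuclideanSpace.proj k : V3 →L[ℝ] ℝ) ∘L fderiv ℝ f x) x :=
    h
  rw [h2.fderiv]
  rfl

section ScalarRules

variable {f g : Plane → ℝ} (i : Fin 2) (x : Plane)

lemma spd_add (hf : Differentiable ℝ f) (hg : Differentiable ℝ g) :
    spd i (fun y => f y + g y) x = spd i f x + spd i g x := by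
  simp [spd, fderiv_fun_add (hf x) (hg x)]

lemma spd_sub (hf : Differentiable ℝ f) (hg : Differentiable ℝ g) :
    spd i (fun y => f y - g y) x = spd i f x - spd i g x := by
  simp [spd, fderiv_fun_sub (hf x) (hg x)]

lemma spd_neg : spd i (fun y => -f y) x = -spd i f x := by
  simp [spd, fderiv_fun_neg]

lemma spd_mul (hf : Differentiable ℝ f) (hg : Differentiable ℝ g) :
    spd i (fun y => f y * g y) x = spd i f x * g x + f x * spd i g x := by
  simp [spd, fderiv_fun_mul (hf x) (hg x)]
  ring

lemma spd_comp {u : ℝ → ℝ} {u' : ℝ} (hf : Differentiable ℝ f) (hu : HasDerivAt u u' (f x)) :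
    spd i (fun y => u (f y)) x = u' * spd i f x := by
  have h : HasFDerivAt (fun y => u (f y)) _ x := hu.comp_hasFDerivAt x (hf x).hasFDerivAt
  simp [spd, h.fderiv]

lemma spd_coord (j : Fin 2) : spd i (fun y : Plane => y j) x = if i = j then 1 else 0 := by
  have h : HasFDerivAt (fun y : Plane => y j) (EuclideanSpace.proj j : Plane →L[ℝ] ℝ) x :=
    (EuclideanSpace.proj j : Plane →L[ℝ] ℝ).hasFDerivAt
  simp [spd, h.fderiv, eq_comm]

end ScalarRules

lemma pd_neg (f : Plane → V3) (i : Fin 2) (x : Plane) :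
    pd i (fun y => -f y) x = -pd i f x := by
  simp [pd, fderiv_fun_neg]

lemma pd_zero (i : Fin 2) (x : Plane) : pd i (fun _ => (0 : V3)) x = 0 := by
  simp [pd]

lemma differentiable_coord {f : Plane → V3} (hf : Differentiable ℝ f) (k : Fin 3) :
    Differentiable ℝ (fun y => f y k) :=
  differentiable_euclidean.1 hf k

lemma contDiff_cross {n : WithTop ℕ∞} {f g : Plane → V3} (hf : ContDiff ℝ n f)
    (hg : ContDiff ℝ n g) : ContDiff ℝ n (fun y => cross (f y) (g y)) := by
  rw [contDiff_euclidean] at *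
  intro k
  fin_cases k
  · exact ((hf 1).mul (hg 2)).sub ((hf 2).mul (hg 1))
  · exact ((hf 2).mul (hg 0)).sub ((hf 0).mul (hg 2))
  · exact ((hf 0).mul (hg 1)).sub ((hf 1).mul (hg 0))

lemma pd_cross {f g : Plane → V3} (hf : ContDiff ℝ 1 f) (hg : ContDiff ℝ 1 g) (i : Fin 2)
    (x : Plane) : pd i (fun y => cross (f y) (g y)) x = cross (pd i f x) (g x)
      + cross (f x) (pd i g x) := by
  have hf' := hf.differentiable one_ne_zero
  have hg' := hg.differentiable one_ne_zero
  have hF := differentiable_coord hf'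
  have hG := differentiable_coord hg'
  have hc := (contDiff_cross hf hg).differentiable one_ne_zero
  ext k
  rw [pd_apply hc]
  fin_cases k <;>
  · simp only [Fin.zero_eta, Fin.mk_one, Fin.reduceFinMk, cross_apply_zero, cross_apply_one,
      cross_apply_two, PiLp.add_apply, pd_apply hf', pd_apply hg']
    rw [spd_sub _ _ ((hF _).fun_mul (hG _)) ((hF _).fun_mul (hG _)), spd_mul _ _ (hF _) (hG _),
      spd_mul _ _ (hF _) (hG _)]
    ring

/-- Metric compatibility of the covariant derivative. -/
lemma spd_inner (a : V3) {f g : Plane → V3} (hf : Differentiable ℝ f) (hg : Differentiable ℝ g)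
    (i : Fin 2) (x : Plane) :
    spd i (fun y => inner ℝ (f y) (g y)) x
      = inner ℝ (pd i f x + cross a (f x)) (g x) + inner ℝ (f x) (pd i g x + cross a (g x)) := by
  have h := inner_cross_left_add a (f x) (g x)
  simp only [spd, pd, fderiv_inner_apply ℝ (hf x) (hg x), inner_add_left, inner_add_right]
  linarith

lemma contDiff_pd {f : Plane → V3} (hf : ContDiff ℝ (⊤ : ℕ∞) f) (i : Fin 2) :
    ContDiff ℝ (⊤ : ℕ∞) (pd i f) :=
  (hf.fderiv_right (m := (⊤ : ℕ∞)) (by simp)).clm_apply contDiff_const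

lemma contDiff_spd {f : Plane → ℝ} (hf : ContDiff ℝ (⊤ : ℕ∞) f) (i : Fin 2) :
    ContDiff ℝ (⊤ : ℕ∞) (spd i f) :=
  (hf.fderiv_right (m := (⊤ : ℕ∞)) (by simp)).clm_apply contDiff_const

lemma continuous_spd {f : Plane → ℝ} (hf : ContDiff ℝ 1 f) (i : Fin 2) :
    Continuous (spd i f) :=
  (hf.continuous_fderiv one_ne_zero).clm_apply continuous_const

lemma fderiv_apply_comm {E : Type*} [NormedAddCommGroup E] [NormedSpace ℝ E] {f : Plane → E}
    (hf : ContDiff ℝ (⊤ : ℕ∞) f) (x v w : Plane) :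
    fderiv ℝ (fun y => fderiv ℝ f y v) x w = fderiv ℝ (fun y => fderiv ℝ f y w) x v := by
  have hd : DifferentiableAt ℝ (fderiv ℝ f) x :=
    ((hf.fderiv_right (m := (⊤ : ℕ∞)) (by simp)).differentiable (by simp)) x
  have hs : IsSymmSndFDerivAt ℝ f x := hf.contDiffAt.isSymmSndFDerivAt (by
    simp only [minSmoothness_of_isRCLikeNormedField]
    exact WithTop.coe_le_coe.2 le_top)
  rw [fderiv_clm_apply hd (by fun_prop), fderiv_clm_apply hd (by fun_prop)]
  simpa using hs.eq w v

lemma pd_comm {f : Plane → V3} (hf : ContDiff ℝ (⊤ : ℕ∞) f) (i j : Fin 2) (x : Plane) :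
    pd i (pd j f) x = pd j (pd i f) x :=
  fderiv_apply_comm hf x _ _

lemma spd_comm {f : Plane → ℝ} (hf : ContDiff ℝ (⊤ : ℕ∞) f) (i j : Fin 2) (x : Plane) :
    spd i (spd j f) x = spd j (spd i f) x :=
  fderiv_apply_comm hf x _ _

lemma eq_const_of_spd_eq_zero {f : Plane → ℝ} (hf : Differentiable ℝ f)
    (h : ∀ i x, spd i f x = 0) (x y : Plane) : f x = f y := by
  refine is_const_of_fderiv_eq_zero hf (fun z => ?_) x y
  ext v
  have hv : v = ∑ i, v i • (EuclideanSpace.single i (1 : ℝ) : Plane) := by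
    ext k
    fin_cases k <;> simp [Fin.sum_univ_two]
  rw [hv, map_sum]
  simp only [map_smul]
  exact Finset.sum_eq_zero fun i _ => by
    have := h i z
    unfold spd at this
    simp [this]

/-- Cutoff functions equal to `1` on the ball of radius `R`, vanishing outside the ball of radius
`2 * R`, with gradient of size `O(1 / R)`. -/
lemma exists_cutoff : ∃ C : ℝ, 0 ≤ C ∧ ∀ R : ℝ, 0 < R → ∃ η : Plane → ℝ,
    ContDiff ℝ 1 η ∧ HasCompactSupport η ∧ (∀ x, 0 ≤ η x) ∧ (∀ x, η x ≤ 1) ∧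
    (∀ x, ‖x‖ ≤ R → η x = 1) ∧ (∀ x, 2 * R ≤ ‖x‖ → η x = 0) ∧
    (∀ i x, |spd i η x| ≤ C / R) ∧ (∀ i x, ‖x‖ < R → spd i η x = 0) ∧
    (∀ i x, 2 * R < ‖x‖ → spd i η x = 0) := by
  let f : ContDiffBump (0 : Plane) := ⟨1, 2, by norm_num, by norm_num⟩
  have hf : ContDiff ℝ 1 f := f.contDiff
  obtain ⟨C, hC⟩ := (hf.continuous_fderiv one_ne_zero).bounded_above_of_compact_support
    (f.hasCompactSupport.fderiv (𝕜 := ℝ))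
  refine ⟨C, (norm_nonneg _).trans (hC 0), fun R hR => ⟨fun x => f (R⁻¹ • x), ?_⟩⟩
  have hcd : ContDiff ℝ 1 (fun x : Plane => f (R⁻¹ • x)) := hf.comp (contDiff_const_smul _)
  have hnorm : ∀ x : Plane, ‖R⁻¹ • x‖ = ‖x‖ / R := fun x => by
    rw [norm_smul, norm_inv, Real.norm_of_nonneg hR.le]; field_simp
  have hone : ∀ x : Plane, ‖x‖ ≤ R → f (R⁻¹ • x) = 1 := fun x hx =>
    f.one_of_mem_closedBall (by
      rw [mem_closedBall_zero_iff, hnorm]; exact (div_le_one hR).2 hx)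
  have hzero : ∀ x : Plane, 2 * R ≤ ‖x‖ → f (R⁻¹ • x) = 0 := fun x hx =>
    f.zero_of_le_dist (by
      rw [dist_zero_right, hnorm]; exact (le_div_iff₀ hR).2 hx)
  refine ⟨hcd, ?_, fun x => f.nonneg, fun x => f.le_one, hone, hzero, ?_, ?_, ?_⟩
  · refine HasCompactSupport.of_support_subset_isCompact (isCompact_closedBall 0 (2 * R)) ?_
    intro x hx
    by_contra h
    exact hx (hzero x (by simpa using (not_le.1 (by simpa using h)).le))
  · intro i x
    have hd : HasFDerivAt (fun y : Plane => f (R⁻¹ • y))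
        ((fderiv ℝ f (R⁻¹ • x)) ∘L (R⁻¹ • ContinuousLinearMap.id ℝ Plane)) x :=
      ((hf.differentiable one_ne_zero) (R⁻¹ • x)).hasFDerivAt.comp x
        ((hasFDerivAt_id x).const_smul R⁻¹)
    have h1 := (fderiv ℝ f (R⁻¹ • x)).le_opNorm (EuclideanSpace.single i (1 : ℝ))
    have h2 := hC (R⁻¹ • x)
    have h3 : |fderiv ℝ f (R⁻¹ • x) (EuclideanSpace.single i (1 : ℝ))| ≤ C := by
      simp only [PiLp.norm_single, norm_one, mul_one, Real.norm_eq_abs] at h1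
      exact h1.trans h2
    simp only [spd, hd.fderiv, ContinuousLinearMap.comp_apply, smul_apply,
      ContinuousLinearMap.id_apply, map_smul, smul_eq_mul, abs_mul, abs_inv, abs_of_pos hR]
    rw [div_eq_inv_mul]
    gcongr
  · intro i x hx
    have : (fun y : Plane => f (R⁻¹ • y)) =ᶠ[nhds x] fun _ => (1 : ℝ) := by
      filter_upwards [(isOpen_lt continuous_norm continuous_const).mem_nhds hx] with y hy
      exact hone y (le_of_lt hy)
    simp [spd, this.fderiv_eq]
  · intro i x hx
    have : (fun y : Plane => f (R⁻¹ • y)) =ᶠ[nhds x] fun _ => (0 : ℝ) := by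
      filter_upwards [(isOpen_lt continuous_const continuous_norm).mem_nhds hx] with y hy
      exact hzero y (le_of_lt hy)
    simp [spd, this.fderiv_eq]

lemma integral_mul_divergence {η : Plane → ℝ} {X : Fin 2 → Plane → ℝ} (hη : ContDiff ℝ 1 η)
    (hc : HasCompactSupport η) (hX : ∀ i, ContDiff ℝ 1 (X i)) :
    ∫ x, η x * ∑ i, spd i (X i) x = ∫ x, -∑ i, spd i η x * X i x := by
  have hc' : ∀ i, HasCompactSupport (spd i η) := fun i =>
    hc.fderiv_apply (𝕜 := ℝ) (EuclideanSpace.single i 1)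
  have h1 : ∀ i, Integrable (fun x => η x * spd i (X i) x) := fun i =>
    (hη.continuous.mul (continuous_spd (hX i) i)).integrable_of_hasCompactSupport hc.mul_right
  have h2 : ∀ i, Integrable (fun x => spd i η x * X i x) := fun i =>
    ((continuous_spd hη i).mul (hX i).continuous).integrable_of_hasCompactSupport
      (hc' i).mul_right
  have h3 : ∀ i, Integrable (fun x => η x * X i x) := fun i =>
    (hη.continuous.mul (hX i).continuous).integrable_of_hasCompactSupport hc.mul_right
  simp only [Finset.mul_sum]
  rw [integral_finsetSum _ fun i _ => h1 i, integral_neg, integral_finsetSum _ fun i _ => h2 i,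
    ← Finset.sum_neg_distrib]
  refine Finset.sum_congr rfl fun i _ => ?_
  exact integral_mul_fderiv_eq_neg_fderiv_mul_of_integrable (h2 i) (h1 i) (h3 i)
    (fun x _ => hη.differentiable one_ne_zero x) (fun x _ => (hX i).differentiable one_ne_zero x)

lemma tendsto_integral_norm_ge {e : Plane → ℝ} (he : Integrable e) :
    Filter.Tendsto (fun R : ℝ => ∫ x in {x : Plane | R ≤ ‖x‖}, e x) Filter.atTop (nhds 0) := by
  have h := tendsto_setIntegral_of_antitone (μ := volume) (f := e)
    (s := fun R : ℝ => {x : Plane | R ≤ ‖x‖})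
    (fun R => (isClosed_le continuous_const continuous_norm).measurableSet)
    (fun R S hRS x hx => le_trans hRS hx) ⟨0, he.integrableOn⟩
  have : (⋂ R : ℝ, {x : Plane | R ≤ ‖x‖}) = ∅ := by
    ext x
    simpa using ⟨‖x‖ + 1, by linarith⟩
  simpa [this] using h

/-- A vector field on the plane with nonnegative divergence and small flux at infinity is
divergence free. -/
lemma divergence_eq_zero_of_nonneg {X : Fin 2 → Plane → ℝ} (hX : ∀ i, ContDiff ℝ 1 (X i))
    (hpos : ∀ x, 0 ≤ ∑ i, spd i (X i) x)
    (hgrow : ∀ δ : ℝ, 0 < δ → ∃ e : Plane → ℝ, Integrable e ∧ (∀ x, 0 ≤ e x) ∧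
      ∀ R : ℝ, 1 ≤ R → ∀ i x, ‖x‖ ≤ 2 * R → |X i x| ≤ δ / R + R * e x) (x : Plane) :
    ∑ i, spd i (X i) x = 0 := by
  obtain ⟨C, hC, hcut⟩ := exists_cutoff
  set v : ℝ := volume.real (Metric.closedBall (0 : Plane) 1) with hv
  have hd : Continuous (fun x => ∑ i, spd i (X i) x) :=
    continuous_finsetSum _ fun i _ => continuous_spd (hX i) i
  have h_int : ∀ δ : ℝ, 0 < δ → ∀ R₀ : ℝ, 1 ≤ R₀ → ∃ R, R₀ ≤ R ∧ ∀ η : Plane → ℝ,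
      ContDiff ℝ 1 η → HasCompactSupport η → (∀ i x, |spd i η x| ≤ C / R) →
      (∀ i x, ‖x‖ < R → spd i η x = 0) → (∀ i x, 2 * R < ‖x‖ → spd i η x = 0) →
      ∫ x, η x * ∑ i, spd i (X i) x ≤ δ * (8 * C * v + 2 * C) := by
    intro δ hδ R₀ hR₀
    obtain ⟨e, he, he0, hXe⟩ := hgrow δ hδ
    obtain ⟨R, hRδ, hR⟩ := (((tendsto_integral_norm_ge he).eventually_lt_const hδ).and
      (Filter.eventually_ge_atTop R₀)).exists
    refine ⟨R, hR, fun η hη hc hb hin hout => ?_⟩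
    have hR1 : 1 ≤ R := hR₀.trans hR
    have hR0 : 0 < R := by linarith
    have hmB : MeasurableSet (Metric.closedBall (0 : Plane) (2 * R)) :=
      Metric.isClosed_closedBall.measurableSet
    have hmT : MeasurableSet {x : Plane | R ≤ ‖x‖} :=
      (isClosed_le continuous_const continuous_norm).measurableSet
    have hvol : volume.real (Metric.closedBall (0 : Plane) (2 * R)) = 4 * R ^ 2 * v := by
      rw [hv, measureReal_def, measureReal_def, Measure.addHaar_closedBall' volume _ (by positivity),
        ENNReal.toReal_mul, ENNReal.toReal_ofReal (by positivity)]
      simp only [finrank_euclideanSpace, Fintype.card_fin]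
      ring
    have hfinB : volume (Metric.closedBall (0 : Plane) (2 * R)) ≠ ⊤ :=
      (isCompact_closedBall _ _).measure_lt_top.ne
    have hg1 : Integrable ((Metric.closedBall (0 : Plane) (2 * R)).indicator
        fun _ => 2 * C * δ / R ^ 2) :=
      (integrable_indicator_iff hmB).2 (integrableOn_const hfinB)
    have hg2 : Integrable ({x : Plane | R ≤ ‖x‖}.indicator fun x => 2 * C * e x) :=
      (he.const_mul _).indicator hmT
    have hbound : ∀ x, -∑ i, spd i η x * X i x ≤
        (Metric.closedBall (0 : Plane) (2 * R)).indicator (fun _ => 2 * C * δ / R ^ 2) x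
        + {x : Plane | R ≤ ‖x‖}.indicator (fun x => 2 * C * e x) x := by
      intro x
      by_cases h1 : ‖x‖ < R
      · simp only [hin _ x h1, zero_mul, Finset.sum_const_zero, neg_zero]
        exact add_nonneg (Set.indicator_nonneg (fun _ _ => by positivity) _)
          (Set.indicator_nonneg (fun y _ => mul_nonneg (by positivity) (he0 y)) _)
      by_cases h2 : 2 * R < ‖x‖
      · simp only [hout _ x h2, zero_mul, Finset.sum_const_zero, neg_zero]
        exact add_nonneg (Set.indicator_nonneg (fun _ _ => by positivity) _)
          (Set.indicator_nonneg (fun y _ => mul_nonneg (by positivity) (he0 y)) _)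
      rw [not_lt] at h1 h2
      rw [Set.indicator_of_mem (by simpa using h2), Set.indicator_of_mem (by simpa using h1)]
      have key : ∀ i, -(spd i η x * X i x) ≤ C / R * (δ / R + R * e x) := fun i => by
        refine (neg_le_abs _).trans ?_
        rw [abs_mul]
        exact mul_le_mul (hb i x) (hXe R hR1 i x h2) (abs_nonneg _) (by positivity)
      have hk : C / R * (δ / R + R * e x) = C * δ / R ^ 2 + C * e x := by
        field_simp
      have k0 := key 0
      have k1 := key 1
      rw [hk] at k0 k1
      rw [Fin.sum_univ_two]
      have : 2 * C * δ / R ^ 2 = 2 * (C * δ / R ^ 2) := by ring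
      linarith
    rw [integral_mul_divergence hη hc hX]
    have hleft : Integrable fun x => -∑ i, spd i η x * X i x := by
      refine (integrable_finsetSum _ fun i _ => ?_).neg
      exact ((continuous_spd hη i).mul (hX i).continuous).integrable_of_hasCompactSupport
        ((hc.fderiv_apply (𝕜 := ℝ) (EuclideanSpace.single i 1)).mul_right)
    refine (integral_mono hleft (hg1.add hg2) hbound).trans ?_
    rw [integral_add' hg1 hg2, integral_indicator hmB, integral_indicator hmT,
      setIntegral_const, hvol, integral_const_mul, smul_eq_mul]
    have h8 : 4 * R ^ 2 * v * (2 * C * δ / R ^ 2) = δ * (8 * C * v) := by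
      field_simp
      ring
    rw [h8]
    have := mul_le_mul_of_nonneg_left hRδ.le (by positivity : 0 ≤ 2 * C)
    linarith
  set R₁ : ℝ := ‖x‖ + 1 with hR₁
  have hR₁pos : 0 < R₁ := by positivity
  obtain ⟨η₁, hη₁, hc₁, hn₁, hl₁, hone₁, hzero₁, -⟩ := hcut R₁ hR₁pos
  have hcont₁ : Continuous fun x => η₁ x * ∑ i, spd i (X i) x := hη₁.continuous.mul hd
  have hcs₁ : HasCompactSupport fun x => η₁ x * ∑ i, spd i (X i) x := hc₁.mul_right
  have hle : ∀ δ : ℝ, 0 < δ → ∫ x, η₁ x * ∑ i, spd i (X i) x ≤ δ * (8 * C * v + 2 * C) := by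
    intro δ hδ
    obtain ⟨R, hR, hI⟩ := h_int δ hδ (2 * R₁) (by linarith [norm_nonneg x])
    obtain ⟨η, hη, hc, hn, hl, hone, hzero, hb, hin, hout⟩ := hcut R (by linarith)
    refine le_trans ?_ (hI η hη hc hb hin hout)
    refine integral_mono (hcont₁.integrable_of_hasCompactSupport hcs₁)
      ((hη.continuous.mul hd).integrable_of_hasCompactSupport hc.mul_right) fun y => ?_
    refine mul_le_mul_of_nonneg_right ?_ (hpos y)
    rcases le_total ‖y‖ (2 * R₁) with h | h
    · rw [hone y (h.trans hR)]
      exact hl₁ y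
    · rw [hzero₁ y h]
      exact hn y
  by_contra hne
  have hpos' := hcont₁.integral_pos_of_hasCompactSupport_nonneg_nonzero (μ := volume) (x := x) hcs₁
    (fun y => mul_nonneg (hn₁ y) (hpos y))
    (by rw [hone₁ x (by linarith), one_mul]; exact hne)
  set I := ∫ x, η₁ x * ∑ i, spd i (X i) x
  have hv0 : 0 ≤ v := measureReal_nonneg
  have hK : 0 ≤ 8 * C * v + 2 * C := by positivity
  have h := hle (I / (2 * (8 * C * v + 2 * C + 1))) (by positivity)
  rw [div_mul_eq_mul_div, le_div_iff₀ (by positivity)] at h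
  nlinarith

section Smoothness

variable {A : Fin 2 → Plane → V3} {f : Plane → V3}

lemma contDiff_covD (hA : ∀ i, ContDiff ℝ (⊤ : ℕ∞) (A i)) (hf : ContDiff ℝ (⊤ : ℕ∞) f)
    (i : Fin 2) : ContDiff ℝ (⊤ : ℕ∞) (covD A f i) :=
  (contDiff_pd hf i).add (contDiff_cross (hA i) hf)

lemma contDiff_Fel (hA : ∀ i, ContDiff ℝ (⊤ : ℕ∞) (A i)) (hf : ContDiff ℝ (⊤ : ℕ∞) f)
    (i : Fin 2) : ContDiff ℝ (⊤ : ℕ∞) (Fel A f i) :=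
  contDiff_covD hA hf i

lemma contDiff_curv (hA : ∀ i, ContDiff ℝ (⊤ : ℕ∞) (A i)) (i j : Fin 2) :
    ContDiff ℝ (⊤ : ℕ∞) (curv A i j) :=
  ((contDiff_pd (hA j) i).sub (contDiff_pd (hA i) j)).add (contDiff_cross (hA i) (hA j))

end Smoothness

lemma differentiable_of_smooth {E : Type*} [NormedAddCommGroup E] [NormedSpace ℝ E]
    {f : Plane → E} (hf : ContDiff ℝ (⊤ : ℕ∞) f) : Differentiable ℝ f :=
  hf.differentiable (by simp)

lemma contDiff_one_of_smooth {E : Type*} [NormedAddCommGroup E] [NormedSpace ℝ E]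
    {f : Plane → E} (hf : ContDiff ℝ (⊤ : ℕ∞) f) : ContDiff ℝ 1 f :=
  hf.of_le (by exact_mod_cast le_top)

/-- Gauss's law with finite electric energy forces the electric field and `D₀Φ` to vanish. -/
lemma electric_eq_zero {A : Fin 2 → Plane → V3} {A₀ Φ : Plane → V3}
    (hA : ∀ i, ContDiff ℝ (⊤ : ℕ∞) (A i)) (hA₀ : ContDiff ℝ (⊤ : ℕ∞) A₀)
    (hGauss : ∀ x, ∑ j, (pd j (Fel A A₀ j) x + cross (A j x) (Fel A A₀ j x))
      = cross (Φ x) (cross (A₀ x) (Φ x)))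
    (h_int : Integrable (fun x => ∑ i, ‖Fel A A₀ i x‖ ^ 2)) (x : Plane) :
    (∀ i, Fel A A₀ i x = 0) ∧ cross (A₀ x) (Φ x) = 0 := by
  have hF := fun i => contDiff_Fel hA hA₀ i
  have hFd := fun i => differentiable_of_smooth (hF i)
  have hA₀d := differentiable_of_smooth hA₀
  set s : Plane → ℝ := fun y => inner ℝ (A₀ y) (A₀ y) with hs
  set h : Fin 2 → Plane → ℝ := fun i y => inner ℝ (Fel A A₀ i y) (A₀ y) with hh
  set r : Plane → ℝ := fun y => √(1 + s y) with hr
  have hs0 : ∀ y, 0 ≤ s y := fun y => real_inner_self_nonneg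
  have hr2 : ∀ y, r y ^ 2 = 1 + s y := fun y => Real.sq_sqrt (by linarith [hs0 y])
  have hrpos : ∀ y, 0 < r y := fun y => Real.sqrt_pos.2 (by linarith [hs0 y])
  have hsC : ContDiff ℝ (⊤ : ℕ∞) s := hA₀.inner ℝ hA₀
  have hhC : ∀ i, ContDiff ℝ (⊤ : ℕ∞) (h i) := fun i => (hF i).inner ℝ hA₀
  have hrC : ContDiff ℝ (⊤ : ℕ∞) r :=
    (contDiff_const.add hsC).sqrt fun y => by linarith [hs0 y]
  have hriC : ContDiff ℝ (⊤ : ℕ∞) (fun y => (r y)⁻¹) := hrC.inv fun y => (hrpos y).ne'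
  have hds : ∀ i y, spd i s y = 2 * h i y := fun i y => by
    rw [hs, spd_inner (A i y) hA₀d hA₀d i y]
    simp only [hh, Fel]
    rw [real_inner_comm (pd i A₀ y + cross (A i y) (A₀ y)) (A₀ y)]
    ring
  have hdri : ∀ i y, spd i (fun y => (r y)⁻¹) y = -h i y / r y ^ 3 := fun i y => by
    have hu : HasDerivAt (fun t : ℝ => (√(1 + t))⁻¹) (-(1 / (2 * √(1 + s y))) / √(1 + s y) ^ 2)
        (s y) :=
      (((hasDerivAt_id (s y)).const_add 1).sqrt (by simp; linarith [hs0 y])).inv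
        (hrpos y).ne'
    have := spd_comp i y (differentiable_of_smooth hsC) hu
    rw [hds] at this
    refine this.trans ?_
    have hrp := hrpos y
    change -(1 / (2 * r y)) / r y ^ 2 * (2 * h i y) = _
    field_simp
  have hdh : ∀ i y, spd i (h i) y = inner ℝ (pd i (Fel A A₀ i) y + cross (A i y) (Fel A A₀ i y))
      (A₀ y) + ‖Fel A A₀ i y‖ ^ 2 := fun i y => by
    rw [hh, spd_inner (A i y) (hFd i) hA₀d i y, ← real_inner_self_eq_norm_sq]
    rfl
  have hsum : ∀ y, ∑ i, spd i (h i) y = ‖cross (A₀ y) (Φ y)‖ ^ 2 + ∑ i, ‖Fel A A₀ i y‖ ^ 2 := by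
    intro y
    simp only [hdh, Finset.sum_add_distrib]
    rw [← sum_inner, hGauss, real_inner_comm, inner_cross_eq, real_inner_self_eq_norm_sq]
  have hcs : ∀ i y, h i y ^ 2 ≤ ‖Fel A A₀ i y‖ ^ 2 * s y := fun i y => by
    have := abs_real_inner_le_norm (Fel A A₀ i y) (A₀ y)
    rw [hs]
    simp only [real_inner_self_eq_norm_sq]
    rw [← mul_pow, ← sq_abs]
    gcongr
  have hdX : ∀ y, ∑ i, spd i (fun y => h i y * (r y)⁻¹) y
      = (‖cross (A₀ y) (Φ y)‖ ^ 2 + ∑ i, ‖Fel A A₀ i y‖ ^ 2) / r y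
        - (∑ i, h i y ^ 2) / r y ^ 3 := fun y => by
    simp only [spd_mul _ y (differentiable_of_smooth (hhC _)) (differentiable_of_smooth hriC),
      hdri, Finset.sum_add_distrib, ← Finset.sum_mul, hsum]
    simp only [Fin.sum_univ_two]
    ring
  have hlow : ∀ y, (‖cross (A₀ y) (Φ y)‖ ^ 2 + ∑ i, ‖Fel A A₀ i y‖ ^ 2) / r y ^ 3
      ≤ ∑ i, spd i (fun y => h i y * (r y)⁻¹) y := fun y => by
    have hrp := hrpos y
    have e1 : (‖cross (A₀ y) (Φ y)‖ ^ 2 + ∑ i, ‖Fel A A₀ i y‖ ^ 2) / r y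
        = (‖cross (A₀ y) (Φ y)‖ ^ 2 + ∑ i, ‖Fel A A₀ i y‖ ^ 2) * (1 + s y) / r y ^ 3 := by
      rw [← hr2]
      field_simp
    rw [hdX, e1, ← sub_div]
    refine div_le_div_of_nonneg_right ?_ (by positivity)
    have h0 := hcs 0 y
    have h1 := hcs 1 y
    simp only [Fin.sum_univ_two]
    nlinarith [mul_nonneg (sq_nonneg ‖cross (A₀ y) (Φ y)‖) (hs0 y)]
  have hzero := divergence_eq_zero_of_nonneg
    (X := fun i y => h i y * (r y)⁻¹)
    (fun i => contDiff_one_of_smooth ((hhC i).mul hriC))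
    (fun y => le_trans (by have := hrpos y; positivity) (hlow y)) (fun δ hδ => by
      refine ⟨fun y => (∑ i, ‖Fel A A₀ i y‖ ^ 2) / δ, h_int.div_const δ,
        fun y => by positivity, fun R hR i y _ => ?_⟩
      have hR0 : 0 < R := by linarith
      have hrp := hrpos y
      have h1 : |h i y * (r y)⁻¹| ≤ ‖Fel A A₀ i y‖ := by
        rw [abs_mul, abs_inv, abs_of_pos hrp, ← div_eq_mul_inv, div_le_iff₀ hrp]
        refine abs_le_of_sq_le_sq ?_ (by positivity)
        rw [mul_pow, hr2]
        nlinarith [hcs i y, sq_nonneg ‖Fel A A₀ i y‖]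
      have h2 : ‖Fel A A₀ i y‖ ^ 2 ≤ ∑ i, ‖Fel A A₀ i y‖ ^ 2 :=
        Finset.single_le_sum (f := fun i => ‖Fel A A₀ i y‖ ^ 2) (fun j _ => by positivity)
          (Finset.mem_univ i)
      have h3 : δ / R + R * (‖Fel A A₀ i y‖ ^ 2 / δ) - ‖Fel A A₀ i y‖
          = ((δ - R * ‖Fel A A₀ i y‖ / 2) ^ 2 + 3 / 4 * (R * ‖Fel A A₀ i y‖) ^ 2) / (R * δ) := by
        field_simp
        ring
      have h4 : 0 ≤ ((δ - R * ‖Fel A A₀ i y‖ / 2) ^ 2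
          + 3 / 4 * (R * ‖Fel A A₀ i y‖) ^ 2) / (R * δ) := by positivity
      have h5 : R * (‖Fel A A₀ i y‖ ^ 2 / δ) ≤ R * ((∑ i, ‖Fel A A₀ i y‖ ^ 2) / δ) := by
        gcongr
      linarith) x
  have hl := hlow x
  rw [hzero, div_le_iff₀ (pow_pos (hrpos x) 3), zero_mul, Fin.sum_univ_two] at hl
  have f0 := sq_nonneg ‖Fel A A₀ 0 x‖
  have f1 := sq_nonneg ‖Fel A A₀ 1 x‖
  have fc := sq_nonneg ‖cross (A₀ x) (Φ x)‖
  have z0 : ‖Fel A A₀ 0 x‖ ^ 2 = 0 := by linarith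
  have z1 : ‖Fel A A₀ 1 x‖ ^ 2 = 0 := by linarith
  have zc : ‖cross (A₀ x) (Φ x)‖ ^ 2 = 0 := by linarith
  refine ⟨fun i => ?_, by simpa using zc⟩
  fin_cases i
  · simpa using z0
  · simpa using z1

/-- Pohozaev's identity in the plane: a finite-energy solution of `Δφ = W'(φ)` with `W ≥ 0` has
zero potential energy density. -/
lemma potential_eq_zero_of_finite_energy {φ : Plane → ℝ} (hφ : ContDiff ℝ (⊤ : ℕ∞) φ)
    {W : ℝ → ℝ} (hW : ContDiff ℝ 1 W) (hW0 : ∀ x, 0 ≤ W (φ x))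
    (heq : ∀ x, ∑ i, spd i (spd i φ) x = deriv W (φ x))
    (h_int : Integrable (fun x => ∑ i, spd i φ x ^ 2 + W (φ x))) (x : Plane) :
    W (φ x) = 0 := by
  set p := spd 0 φ with hp
  set q := spd 1 φ with hq
  set w : Plane → ℝ := fun y => W (φ y) with hw
  have hpC : ContDiff ℝ 1 p := contDiff_one_of_smooth (contDiff_spd hφ 0)
  have hqC : ContDiff ℝ 1 q := contDiff_one_of_smooth (contDiff_spd hφ 1)
  have hwC : ContDiff ℝ 1 w := hW.comp (contDiff_one_of_smooth hφ)
  have hpd := hpC.differentiable one_ne_zero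
  have hqd := hqC.differentiable one_ne_zero
  have hwd := hwC.differentiable one_ne_zero
  have hxC : ∀ j : Fin 2, ContDiff ℝ 1 (fun y : Plane => y j) := fun j =>
    (EuclideanSpace.proj j : Plane →L[ℝ] ℝ).contDiff
  have hxd := fun j => (hxC j).differentiable one_ne_zero
  set X : Fin 2 → Plane → ℝ :=
    ![fun y => y 0 * (w y - (p y * p y - q y * q y) * (1 / 2)) - y 1 * (p y * q y),
      fun y => y 1 * (w y + (p y * p y - q y * q y) * (1 / 2)) - y 0 * (p y * q y)] with hXdef
  have hdpq : Differentiable ℝ fun y => p y * q y := hpd.fun_mul hqd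
  have hpp : Differentiable ℝ fun y => p y * p y := hpd.fun_mul hpd
  have hqq : Differentiable ℝ fun y => q y * q y := hqd.fun_mul hqd
  have hdiff : Differentiable ℝ fun y => p y * p y - q y * q y := hpp.fun_sub hqq
  have hhalf : Differentiable ℝ fun _ : Plane => (1 / 2 : ℝ) := differentiable_const _
  have hdh : Differentiable ℝ fun y => (p y * p y - q y * q y) * (1 / 2) := hdiff.fun_mul hhalf
  have hX : ∀ i, ContDiff ℝ 1 (X i) := by
    intro i
    have h2 : ContDiff ℝ 1 fun y => (p y * p y - q y * q y) * (1 / 2) :=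
      ((hpC.mul hpC).sub (hqC.mul hqC)).mul contDiff_const
    fin_cases i
    · exact ((hxC 0).mul (hwC.sub h2)).sub ((hxC 1).mul (hpC.mul hqC))
    · exact ((hxC 1).mul (hwC.add h2)).sub ((hxC 0).mul (hpC.mul hqC))
  have hdw : ∀ i y, spd i w y = deriv W (φ y) * spd i φ y := fun i y =>
    spd_comp i y (differentiable_of_smooth hφ) ((hW.differentiable one_ne_zero) (φ y)).hasDerivAt
  have hhalf0 : ∀ i y, spd i (fun _ : Plane => (1 / 2 : ℝ)) y = 0 := fun i y => by simp [spd]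
  have hdiv : ∀ y, ∑ i, spd i (X i) y = 2 * w y := by
    intro y
    have e0 : spd 0 (X 0) y = _ :=
      spd_sub 0 y ((hxd 0).fun_mul (hwd.fun_sub hdh)) ((hxd 1).fun_mul hdpq)
    have e1 : spd 1 (X 1) y = _ :=
      spd_sub 1 y ((hxd 1).fun_mul (hwd.fun_add hdh)) ((hxd 0).fun_mul hdpq)
    have hc : spd 1 p y = spd 0 q y := spd_comm hφ 1 0 y
    have hl := heq y
    rw [Fin.sum_univ_two] at hl
    rw [Fin.sum_univ_two, e0, e1, spd_mul 0 y (hxd 0) (hwd.fun_sub hdh),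
      spd_mul 0 y (hxd 1) hdpq, spd_mul 1 y (hxd 1) (hwd.fun_add hdh),
      spd_mul 1 y (hxd 0) hdpq, spd_sub 0 y hwd hdh, spd_add 1 y hwd hdh,
      spd_mul 0 y hdiff hhalf, spd_mul 1 y hdiff hhalf, spd_sub 0 y hpp hqq, spd_sub 1 y hpp hqq,
      spd_mul 0 y hpd hqd, spd_mul 1 y hpd hqd, spd_mul 0 y hpd hpd, spd_mul 1 y hpd hpd,
      spd_mul 0 y hqd hqd, spd_mul 1 y hqd hqd, hdw, hdw, hhalf0, hhalf0, hc, ← hl,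
      spd_coord, spd_coord, spd_coord, spd_coord, ← hp, ← hq]
    simp only [if_true, zero_ne_one, one_ne_zero, if_false]
    ring
  have hxle : ∀ (y : Plane) j, |y j| ≤ ‖y‖ := fun y j => PiLp.norm_apply_le y j
  have hz := divergence_eq_zero_of_nonneg hX (fun y => by rw [hdiv]; linarith [hW0 y])
    (fun δ hδ => ⟨_, h_int.const_mul 4, fun y => mul_nonneg (by norm_num)
      (add_nonneg (Finset.sum_nonneg fun i _ => sq_nonneg _) (hW0 y)), fun R hR i y hy => by
        have hR0 : 0 < R := by linarith
        refine le_trans ?_ (le_add_of_nonneg_left (by positivity))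
        rw [Fin.sum_univ_two, ← hp, ← hq]
        have hw0 : 0 ≤ w y := hW0 y
        have bound : ∀ a b c d : ℝ, |a| ≤ 2 * R → |b| ≤ 2 * R →
            |c| ≤ p y ^ 2 + q y ^ 2 + w y → |d| ≤ p y ^ 2 + q y ^ 2 + w y →
            |a * c - b * d| ≤ R * (4 * (p y ^ 2 + q y ^ 2 + w y)) := by
          intro a b c d ha hb hc hd
          have h1 : |a * c| ≤ 2 * R * (p y ^ 2 + q y ^ 2 + w y) := by
            rw [abs_mul]
            exact mul_le_mul ha hc (abs_nonneg _) (by positivity)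
          have h2 : |b * d| ≤ 2 * R * (p y ^ 2 + q y ^ 2 + w y) := by
            rw [abs_mul]
            exact mul_le_mul hb hd (abs_nonneg _) (by positivity)
          have := abs_sub (a * c) (b * d)
          linarith
        have hpq : |p y * q y| ≤ p y ^ 2 + q y ^ 2 + w y := by
          rw [abs_le]
          constructor <;> nlinarith [sq_nonneg (p y + q y), sq_nonneg (p y - q y)]
        fin_cases i
        · refine bound (y 0) (y 1) _ _ ((hxle y 0).trans hy) ((hxle y 1).trans hy) ?_ hpq
          rw [abs_le]
          constructor <;> nlinarith [sq_nonneg (p y), sq_nonneg (q y)]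
        · refine bound (y 1) (y 0) _ _ ((hxle y 1).trans hy) ((hxle y 0).trans hy) ?_ hpq
          rw [abs_le]
          constructor <;> nlinarith [sq_nonneg (p y), sq_nonneg (q y)]⟩) x
  rw [hdiv] at hz
  linarith

/-- `[D_i, D_j] A₀ = F_{ij} × A₀`, so a covariantly constant `A₀` is parallel to the curvature. -/
lemma cross_curv_eq_zero {A : Fin 2 → Plane → V3} {A₀ : Plane → V3}
    (hA : ∀ i, ContDiff ℝ (⊤ : ℕ∞) (A i)) (hA₀ : ContDiff ℝ (⊤ : ℕ∞) A₀)
    (hFel : ∀ i x, Fel A A₀ i x = 0) (i j : Fin 2) (x : Plane) :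
    cross (curv A i j x) (A₀ x) = 0 := by
  have hpd : ∀ i, pd i A₀ = fun y => -cross (A i y) (A₀ y) := fun i =>
    funext fun y => eq_neg_of_add_eq_zero_left (hFel i y)
  have h2 : ∀ i j, pd j (pd i A₀) x
      = -(cross (pd j (A i) x) (A₀ x)) + cross (A i x) (cross (A j x) (A₀ x)) := fun i j => by
    rw [hpd i, pd_neg, pd_cross (contDiff_one_of_smooth (hA i)) (contDiff_one_of_smooth hA₀), hpd j,
      cross_neg_right, neg_add, neg_neg]
  have hc := pd_comm hA₀ j i x
  rw [h2, h2] at hc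
  rw [curv, sub_eq_add_neg, cross_add_left, cross_add_left, cross_neg_left, cross_jacobi]
  have := sub_eq_zero.2 hc
  rw [← this]
  abel

lemma eq_zero_of_integrable_const {c : ℝ} (h : Integrable (fun _ : Plane => c)) : c = 0 := by
  rcases integrable_const_iff.1 h with h | h
  · exact h
  · exact absurd (measure_lt_top (volume : Measure Plane) Set.univ) (by simp)

lemma spd_const (i : Fin 2) (c : ℝ) (x : Plane) : spd i (fun _ => c) x = 0 := by
  simp [spd]

theorem nonabelian_julia_zee
    (U : ℝ → ℝ) (hU : ContDiff ℝ 1 U) (hUnonneg : ∀ s, 0 ≤ s → 0 ≤ U s)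
    (θsq : ℝ) (hθ : 0 ≤ θsq) (hUzero : ∀ s, 0 ≤ s → (U s = 0 ↔ s = θsq))
    (Φ : Plane → V3) (A : Fin 2 → Plane → V3) (A₀ : Plane → V3)
    (hΦ : ContDiff ℝ (⊤ : ℕ∞) Φ) (hA : ∀ i, ContDiff ℝ (⊤ : ℕ∞) (A i)) (hA₀ : ContDiff ℝ (⊤ : ℕ∞) A₀)
    -- the static Yang–Mills equations D^μF_{μi} + Φ × D_iΦ = 0 (i = 1,2),
    -- where D_0F_{0i} = A₀ × F_{0i} = −A₀ × F_{i0} and D^j = −D_j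
    (hYM : ∀ i x, -cross (A₀ x) (Fel A A₀ i x)
        - ∑ j, (pd j (fun y => curv A j i y) x + cross (A j x) (curv A j i x))
        + cross (Φ x) (covD A Φ i x) = 0)
    -- the static Higgs equation D^μD_μΦ + δV/δΦ = 0 with V(Φ) = U(|Φ|²),
    -- where D_0D_0Φ = A₀ × (A₀ × Φ) and δV/δΦ = 2U'(|Φ|²)Φ
    (hHiggs : ∀ x, cross (A₀ x) (cross (A₀ x) (Φ x))
        - ∑ j, (pd j (fun y => covD A Φ j y) x + cross (A j x) (covD A Φ j x))
        + (2 * deriv U (‖Φ x‖ ^ 2)) • Φ x = 0)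
    -- the static Gauss-law constraint D^μF_{μ0} + Φ × D₀Φ = 0
    (hGauss : ∀ x, -(∑ j, (pd j (fun y => Fel A A₀ j y) x
        + cross (A j x) (Fel A A₀ j x)))
        + cross (Φ x) (cross (A₀ x) (Φ x)) = 0)
    -- finite total energy
    (hfin : Integrable (fun x =>
        (1 / 4) * ∑ i, ∑ j, ‖curv A i j x‖ ^ 2
        + (1 / 2) * ∑ i, ‖Fel A A₀ i x‖ ^ 2
        + (1 / 2) * ∑ i, ‖covD A Φ i x‖ ^ 2
        + (1 / 2) * ‖cross (A₀ x) (Φ x)‖ ^ 2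
        + U (‖Φ x‖ ^ 2))) :
    (∀ x, A₀ x = 0) ∨
    ((∀ x, ‖Φ x‖ ^ 2 = θsq) ∧
     (∀ i j x, curv A i j x = 0) ∧
     (∀ i x, Fel A A₀ i x = 0) ∧
     (∀ x, cross (A₀ x) (Φ x) = 0) ∧
     (∀ i x, covD A Φ i x = 0) ∧
     (∫ x, ((1 / 2) * ∑ i, ‖Fel A A₀ i x‖ ^ 2
        + (1 / 2) * ‖cross (A₀ x) (Φ x)‖ ^ 2)) = 0) := by
  have hFC := fun i => contDiff_Fel hA hA₀ i
  have hDC := fun i => contDiff_covD hA hΦ i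
  have hCC := fun i j => contDiff_curv hA i j
  have hV0 : ∀ x, 0 ≤ U (‖Φ x‖ ^ 2) := fun x => hUnonneg _ (by positivity)
  have hC0 : ∀ x, 0 ≤ ∑ i, ∑ j, ‖curv A i j x‖ ^ 2 := fun x => by positivity
  have hE0 : ∀ x, 0 ≤ ∑ i, ‖Fel A A₀ i x‖ ^ 2 := fun x => by positivity
  have hD0 : ∀ x, 0 ≤ ∑ i, ‖covD A Φ i x‖ ^ 2 := fun x => by positivity
  have hB0 : ∀ x, 0 ≤ ‖cross (A₀ x) (Φ x)‖ ^ 2 := fun x => by positivity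
  have hdom : ∀ {f : Plane → ℝ} (K : ℝ), Continuous f → (∀ x, 0 ≤ f x) →
      (∀ x, f x ≤ K * ((1 / 4) * ∑ i, ∑ j, ‖curv A i j x‖ ^ 2
        + (1 / 2) * ∑ i, ‖Fel A A₀ i x‖ ^ 2
        + (1 / 2) * ∑ i, ‖covD A Φ i x‖ ^ 2
        + (1 / 2) * ‖cross (A₀ x) (Φ x)‖ ^ 2
        + U (‖Φ x‖ ^ 2))) → Integrable f := fun K hf h0 hle =>
    (hfin.const_mul K).mono' hf.aestronglyMeasurable
      (Filter.Eventually.of_forall fun x => by rw [Real.norm_of_nonneg (h0 x)]; exact hle x)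
  have hEint : Integrable fun x => ∑ i, ‖Fel A A₀ i x‖ ^ 2 := by
    refine hdom 2 (continuous_finsetSum _ fun i _ => (hFC i).continuous.norm.pow 2) hE0 fun x => ?_
    linarith [hV0 x, hC0 x, hE0 x, hD0 x, hB0 x]
  have hel := electric_eq_zero (Φ := Φ) hA hA₀
    (fun x => (neg_add_eq_zero.1 (hGauss x))) hEint
  have hFel : ∀ i x, Fel A A₀ i x = 0 := fun i x => (hel x).1 i
  have hB : ∀ x, cross (A₀ x) (Φ x) = 0 := fun x => (hel x).2
  have hA₀d := differentiable_of_smooth hA₀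
  have hΦd := differentiable_of_smooth hΦ
  -- metric compatibility against the covariantly constant field `A₀`
  have hspd : ∀ {f : Plane → V3}, Differentiable ℝ f → ∀ i x,
      spd i (fun y => inner ℝ (f y) (A₀ y)) x = inner ℝ (pd i f x + cross (A i x) (f x)) (A₀ x) := by
    intro f hf i x
    have : pd i A₀ x + cross (A i x) (A₀ x) = 0 := hFel i x
    rw [spd_inner (A i x) hf hA₀d, this, inner_zero_right, add_zero]
  by_cases hz : ∀ x, A₀ x = 0
  · exact Or.inl hz
  right
  obtain ⟨x₀, hx₀⟩ := not_forall.1 hz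
  set c : ℝ := inner ℝ (A₀ x₀) (A₀ x₀) with hc
  have hcpos : 0 < c := real_inner_self_pos.2 hx₀
  have hA₀c : ∀ x, inner ℝ (A₀ x) (A₀ x) = c := fun x =>
    eq_const_of_spd_eq_zero (hA₀d.inner ℝ hA₀d) (fun i y => by
      rw [hspd hA₀d]
      have : pd i A₀ y + cross (A i y) (A₀ y) = 0 := hFel i y
      rw [this, inner_zero_left]) x x₀
  have hA₀n : ∀ x, ‖A₀ x‖ ^ 2 = c := fun x => by rw [← real_inner_self_eq_norm_sq, hA₀c]
  have hA₀ne : ∀ x, A₀ x ≠ 0 := fun x h => by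
    have := hA₀c x
    rw [h, inner_zero_left] at this
    exact hcpos.ne this
  have hcs : ∀ (v : V3) x, (inner ℝ v (A₀ x)) ^ 2 ≤ ‖v‖ ^ 2 * c := fun v x => by
    rw [← hA₀n x, ← mul_pow, ← sq_abs]
    gcongr
    exact abs_real_inner_le_norm _ _
  -- the curvature
  have hcurvself : ∀ i x, curv A i i x = 0 := fun i x => by
    ext k
    fin_cases k <;> simp [curv] <;> ring
  have hcurvanti : ∀ i j x, curv A i j x = -curv A j i x := fun i j x => by
    ext k
    fin_cases k <;> simp [curv] <;> ring
  have hYM' : ∀ i x, inner ℝ (∑ j, (pd j (curv A j i) x + cross (A j x) (curv A j i x))) (A₀ x)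
      = 0 := fun i x => by
    have h := hYM i x
    rw [hFel, cross_zero_right, neg_zero, zero_sub, neg_add_eq_zero] at h
    rw [h, real_inner_comm, inner_cross_eq, hB, inner_zero_left]
  set F : Plane → ℝ := fun x => inner ℝ (curv A 0 1 x) (A₀ x) with hFdef
  have hDself : ∀ i x, pd i (curv A i i) x + cross (A i x) (curv A i i x) = 0 := fun i x => by
    have : curv A i i = fun _ => 0 := funext (hcurvself i)
    rw [this, pd_zero, cross_zero_right, add_zero]
  have hF0 : ∀ i x, spd i F x = 0 := by
    intro i x
    fin_cases i
    · have h := hYM' 1 x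
      rw [Fin.sum_univ_two, hDself, add_zero] at h
      exact (hspd (differentiable_of_smooth (hCC 0 1)) 0 x).trans h
    · have h := hYM' 0 x
      rw [Fin.sum_univ_two, hDself, zero_add] at h
      have hF' : F = fun y => -inner ℝ (curv A 1 0 y) (A₀ y) := funext fun y => by
        rw [hFdef, ← inner_neg_left, ← hcurvanti]
      change spd 1 F x = 0
      rw [hF', spd_neg, hspd (differentiable_of_smooth (hCC 1 0)), h, neg_zero]
  have hFd : Differentiable ℝ F := (differentiable_of_smooth (hCC 0 1)).inner ℝ hA₀d
  have hFc : ∀ x, F x = F x₀ := fun x => eq_const_of_spd_eq_zero hFd hF0 x x₀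
  have hFzero : ∀ x, F x = 0 := by
    have hI : Integrable fun _ : Plane => F x₀ ^ 2 := by
      refine hdom (4 * c) continuous_const (fun _ => sq_nonneg _) fun x => ?_
      have h1 := hcs (curv A 0 1 x) x
      have h2 : ‖curv A 0 1 x‖ ^ 2 ≤ ∑ i, ∑ j, ‖curv A i j x‖ ^ 2 := by
        simp only [Fin.sum_univ_two]
        linarith [sq_nonneg ‖curv A 0 0 x‖, sq_nonneg ‖curv A 1 0 x‖, sq_nonneg ‖curv A 1 1 x‖]
      rw [← hFc x]
      refine h1.trans ?_
      rw [mul_comm, mul_comm (4 : ℝ) c, mul_assoc]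
      refine mul_le_mul_of_nonneg_left ?_ hcpos.le
      linarith [hV0 x, hE0 x, hD0 x, hB0 x]
    intro x
    rw [hFc]
    simpa using eq_zero_of_integrable_const hI
  have hcurv01 : ∀ x, curv A 0 1 x = 0 := fun x => by
    refine eq_zero_of_inner_of_cross (hA₀ne x) ((real_inner_comm _ _).trans (hFzero x)) ?_
    rw [cross_swap, cross_curv_eq_zero hA hA₀ hFel, neg_zero]
  have hcurv : ∀ i j x, curv A i j x = 0 := by
    intro i j x
    fin_cases i <;> fin_cases j
    · exact hcurvself 0 x
    · exact hcurv01 x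
    · exact (hcurvanti 1 0 x).trans (by rw [hcurv01, neg_zero])
    · exact hcurvself 1 x
  -- the Higgs field
  set φ : Plane → ℝ := fun x => inner ℝ (Φ x) (A₀ x) with hφdef
  have hφC : ContDiff ℝ (⊤ : ℕ∞) φ := hΦ.inner ℝ hA₀
  have hφsq : ∀ x, φ x ^ 2 / c = ‖Φ x‖ ^ 2 := fun x => by
    have h := norm_sq_cross (A₀ x) (Φ x)
    rw [hB, norm_zero, hA₀n, real_inner_comm] at h
    rw [div_eq_iff hcpos.ne']
    simp only [hφdef]
    linarith
  have hdφ : ∀ i, spd i φ = fun x => inner ℝ (covD A Φ i x) (A₀ x) := fun i =>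
    funext fun x => hspd hΦd i x
  have hW : ContDiff ℝ 1 fun t : ℝ => c * U (t ^ 2 / c) :=
    contDiff_const.mul (hU.comp ((contDiff_id.pow 2).div_const c))
  have hdW : ∀ t, deriv (fun t : ℝ => c * U (t ^ 2 / c)) t = 2 * deriv U (t ^ 2 / c) * t := by
    intro t
    have h1 : HasDerivAt (fun t : ℝ => t ^ 2 / c) (2 * t / c) t := by
      simpa using (hasDerivAt_pow 2 t).div_const c
    have h2 : HasDerivAt (fun t : ℝ => c * U (t ^ 2 / c)) (c * (deriv U (t ^ 2 / c) * (2 * t / c)))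
        t :=
      (((hU.differentiable one_ne_zero) (t ^ 2 / c)).hasDerivAt.comp t h1).const_mul c
    rw [h2.deriv]
    field_simp
  have hlap : ∀ x, ∑ i, spd i (spd i φ) x = deriv (fun t : ℝ => c * U (t ^ 2 / c)) (φ x) := by
    intro x
    have h := hHiggs x
    rw [hB, cross_zero_right, zero_sub, neg_add_eq_zero] at h
    simp only [hdφ]
    rw [Finset.sum_congr rfl fun i _ => hspd (differentiable_of_smooth (hDC i)) i x, ← sum_inner, h,
      inner_smul_left, hdW, hφsq]
    rfl
  have hφint : Integrable fun x => ∑ i, spd i φ x ^ 2 + c * U (φ x ^ 2 / c) := by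
    refine hdom (2 * c) ?_ (fun x => ?_) fun x => ?_
    · refine (continuous_finsetSum _ fun i _ => ?_).add (hW.continuous.comp hφC.continuous)
      exact (contDiff_spd hφC i).continuous.pow 2
    · rw [hφsq]
      exact add_nonneg (by positivity) (mul_nonneg hcpos.le (hV0 x))
    · rw [hφsq]
      have h1 : ∑ i, spd i φ x ^ 2 ≤ c * ∑ i, ‖covD A Φ i x‖ ^ 2 := by
        rw [Finset.mul_sum]
        refine Finset.sum_le_sum fun i _ => ?_
        rw [hdφ, mul_comm]
        exact hcs _ x
      have h2 : c * (∑ i, ‖covD A Φ i x‖ ^ 2 + U (‖Φ x‖ ^ 2))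
          ≤ c * (2 * ((1 / 4) * ∑ i, ∑ j, ‖curv A i j x‖ ^ 2
            + (1 / 2) * ∑ i, ‖Fel A A₀ i x‖ ^ 2
            + (1 / 2) * ∑ i, ‖covD A Φ i x‖ ^ 2
            + (1 / 2) * ‖cross (A₀ x) (Φ x)‖ ^ 2
            + U (‖Φ x‖ ^ 2))) := by
        refine mul_le_mul_of_nonneg_left ?_ hcpos.le
        linarith [hV0 x, hC0 x, hE0 x, hB0 x]
      linarith
  have hΦnorm : ∀ x, ‖Φ x‖ ^ 2 = θsq := fun x => by
    have h := potential_eq_zero_of_finite_energy hφC hW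
      (fun y => by rw [hφsq]; exact mul_nonneg hcpos.le (hV0 y)) hlap hφint x
    rw [hφsq] at h
    exact (hUzero _ (by positivity)).1 ((mul_eq_zero.1 h).resolve_left hcpos.ne')
  have hφ2 : ∀ x, φ x * φ x = c * θsq := fun x => by
    have h := hφsq x
    rw [hΦnorm, div_eq_iff hcpos.ne'] at h
    linarith
  have hφd := differentiable_of_smooth hφC
  have hdφ0 : ∀ i x, spd i φ x = 0 := by
    intro i x
    have h := spd_mul i x hφd hφd
    rw [funext hφ2, spd_const] at h
    rcases mul_eq_zero.1 (by linarith : φ x * spd i φ x = 0) with h0 | h0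
    · have hφ0 : φ = fun _ => 0 := funext fun y => by
        rw [← mul_self_eq_zero, hφ2, ← hφ2 x, h0, zero_mul]
      rw [hφ0, spd_const]
    · exact h0
  have hcovD : ∀ i x, covD A Φ i x = 0 := by
    intro i x
    refine eq_zero_of_inner_of_cross (hA₀ne x) ?_ ?_
    · rw [real_inner_comm, ← congrFun (hdφ i) x, hdφ0]
    · have h := pd_cross (contDiff_one_of_smooth hA₀) (contDiff_one_of_smooth hΦ) i x
      rw [funext hB, pd_zero, eq_neg_of_add_eq_zero_left (hFel i x)] at h
      have hj := cross_jacobi (A i x) (A₀ x) (Φ x)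
      rw [hB, cross_zero_right, zero_sub] at hj
      rw [cross_neg_left, hj, neg_neg] at h
      rw [covD, cross_add_right, add_comm]
      exact h.symm
  refine ⟨hΦnorm, hcurv, hFel, hB, hcovD, ?_⟩
  simp [hFel, hB]

end
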